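/- arXiv:1202.0371 — 2 statements merged into one kernel-verified Lean document; each statement's English description precedes it below -/
import Mathlib

section
/- Let R be a commutative local ring and N an R-module which is a direct sum of cyclic modules, N = ⊕_{λ∈Λ} R/I_λ where each I_λ is an ideal of R. Then every direct summand of N is also a direct sum of cyclic R-modules, each isomorphic to one of the R/I_λ. -/
open DirectSum

namespace SummandAux

lemma sSupIndep_insert' {R N : Type*} [Ring R] [AddCommGroup N] [Module R N]
    {s : Set (Submodule R N)} (hs : sSupIndep s) {C : Submodule R N}
    (h : Disjoint (sSup s) C) : sSupIndep (insert C s) := by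
  classical
  intro x hx
  by_cases hxC : x = C
  · subst hxC
    refine h.symm.mono_right (sSup_le_sSup ?_)
    rintro y ⟨hy, hy'⟩
    exact hy.resolve_left hy'
  · have hxs : x ∈ s := hx.resolve_left hxC
    have h1 : Disjoint x (sSup (s \ {x})) := hs hxs
    have h2 : Disjoint (x ⊔ sSup (s \ {x})) C :=
      h.mono_left (sup_le (le_sSup hxs) (sSup_le_sSup Set.sdiff_subset))
    refine (h1.disjoint_sup_right_of_disjoint_sup_left h2).mono_right ?_
    refine sSup_le ?_
    rintro y ⟨hy | hy, hy'⟩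
    · exact hy ▸ le_sup_right
    · exact (le_sSup (show y ∈ s \ {x} from ⟨hy, hy'⟩)).trans le_sup_left

section
variable {R : Type} [CommRing R] {ι : Type} (I : ι → Ideal R)

def Good (M : Type) [AddCommGroup M] [Module R M] : Prop :=
  ∃ (J : Type) (f : J → ι), Nonempty (M ≃ₗ[R] Π₀ j, R ⧸ I (f j))

variable {I}

lemma Good.congr {M M' : Type} [AddCommGroup M] [Module R M] [AddCommGroup M'] [Module R M']
    (h : Good I M) (e : M' ≃ₗ[R] M) : Good I M' := by
  obtain ⟨J, f, ⟨g⟩⟩ := h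
  exact ⟨J, f, ⟨e.trans g⟩⟩

lemma good_cyclic (i : ι) : Good I (R ⧸ I i) := by
  classical
  exact ⟨Unit, fun _ => i, ⟨(DirectSum.lid R (R ⧸ I i)  Unit).symm⟩⟩

lemma good_sSup {N : Type} [AddCommGroup N] [Module R N] {s : Set (Submodule R N)}
    (hs : sSupIndep s) (hg : ∀ C ∈ s, Good I C) : Good I (sSup s : Submodule R N) := by
  classical
  choose J f e using fun C : s => hg C.1 C.2
  have hi : iSupIndep (fun C : s => (C : Submodule R N)) := (sSupIndep_iff s).1 hs
  have hinj := hi.dfinsupp_lsum_injective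
  have e1 := LinearEquiv.ofInjective (DFinsupp.lsum ℕ fun i : s => (i : Submodule R N).subtype) hinj
  have hr : LinearMap.range (DFinsupp.lsum ℕ fun i : s => (i : Submodule R N).subtype) = sSup s := by
    rw [← Submodule.iSup_eq_range_dfinsupp_lsum, sSup_eq_iSup']
  have e2 := (LinearEquiv.ofEq _ _ hr.symm).trans e1.symm
  have e3 := e2.trans (DFinsupp.mapRange.linearEquiv (fun C : s => (e C).some))
  exact ⟨Σ C : s, J C, fun x => f x.1 x.2, ⟨e3.trans (DirectSum.sigmaLcurryEquiv R
    (δ := fun (C : s) (j : J C) => R ⧸ I (f C j))).symm⟩⟩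

lemma good_sup {N : Type} [AddCommGroup N] [Module R N] {C D : Submodule R N}
    (h : Disjoint C D) (hC : Good I C) (hD : Good I D) : Good I (C ⊔ D : Submodule R N) := by
  have h1 : sSupIndep (insert D {C}) :=
    sSupIndep_insert' (sSupIndep_singleton C) (by simpa using h)
  have := good_sSup (I := I) h1 (by rintro E (rfl | rfl) <;> assumption)
  rwa [sSup_insert, sSup_singleton, sup_comm] at this

lemma good_bot {N : Type} [AddCommGroup N] [Module R N] : Good I (⊥ : Submodule R N) := by
  have := good_sSup (I := I) (N := N) (s := ∅) sSupIndep_empty (by simp)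
  rwa [sSup_empty] at this

/-- splitting lemma -/
lemma split {N : Type} [AddCommGroup N] [Module R N] {I : Ideal R} (f : N →ₗ[R] R ⧸ I) (c : N)
    (hc : ∀ r ∈ I, r • c = 0) (hu : IsUnit (f c)) :
    IsCompl (Submodule.span R {c}) (LinearMap.ker f) ∧
      Nonempty (Submodule.span R {c} ≃ₗ[R] R ⧸ I) := by
  obtain ⟨v, hv⟩ := hu.exists_right_inv
  obtain ⟨s, rfl⟩ := Ideal.Quotient.mk_surjective v
  have key : ∀ r : R, f (r • c) = 0 → r ∈ I := by
    intro r hr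
    rw [map_smul, Algebra.smul_def] at hr
    have := (hu.mul_left_eq_zero).1 hr
    exact Ideal.Quotient.eq_zero_iff_mem.1 this
  refine ⟨⟨?_, ?_⟩, ?_⟩
  · rw [Submodule.disjoint_def]
    intro x hx hx'
    obtain ⟨r, rfl⟩ := Submodule.mem_span_singleton.1 hx
    exact hc r (key r hx')
  · rw [codisjoint_iff, eq_top_iff]
    intro n _
    obtain ⟨t, ht⟩ := Ideal.Quotient.mk_surjective (f n)
    rw [Submodule.mem_sup]
    refine ⟨(t * s) • c, Submodule.smul_mem _ _ (Submodule.mem_span_singleton_self c),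
      n - (t * s) • c, ?_, by abel⟩
    rw [LinearMap.mem_ker, map_sub, map_smul, Algebra.smul_def, ← ht]
    change Ideal.Quotient.mk I t - Ideal.Quotient.mk I (t * s) * f c = 0
    rw [map_mul]
    linear_combination (- Ideal.Quotient.mk I t) * hv
  · have : Ideal.torsionOf R N c = I := by
      ext r
      rw [Ideal.mem_torsionOf_iff]
      exact ⟨fun h => key r (by rw [h, map_zero]), hc r⟩
    exact ⟨(Ideal.quotTorsionOfEquivSpanSingleton R N c).symm.trans
      (Submodule.quotEquivOfEq _ _ this)⟩

lemma exchange {N : Type} [AddCommGroup N] [Module R N] {I : Ideal R} (π : N →ₗ[R] R ⧸ I)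
    {A Q : Submodule R N} (h : IsCompl A Q) {e a q : N} (he : ∀ r ∈ I, r • e = 0)
    (ha : a ∈ A) (hq : q ∈ Q) (heq : e = a + q) (hu : IsUnit (π a)) :
    ∃ A1 C : Submodule R N, A1 ⊔ C = A ∧ Disjoint A1 C ∧ Nonempty (C ≃ₗ[R] R ⧸ I) ∧
      IsCompl (Submodule.span R {e}) (A1 ⊔ Q) := by
  have hpe : A.projectionOnto Q h e = ⟨a, ha⟩ := by
    rw [heq, map_add, Submodule.projectionOnto_apply_of_mem_right h hq, add_zero]
    exact Submodule.projectionOnto_apply_left h ⟨a, ha⟩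
  have hIa : ∀ r ∈ I, r • a = 0 := by
    intro r hr
    have := congrArg (A.projectionOnto Q h) (he r hr)
    rw [map_smul, hpe, map_zero] at this
    exact congrArg Subtype.val this
  obtain ⟨h1, h2⟩ := split π a hIa hu
  have hCA : Submodule.span R {a} ≤ A := by
    rw [Submodule.span_singleton_le_iff_mem]; exact ha
  refine ⟨A ⊓ LinearMap.ker π, Submodule.span R {a}, ?_, ?_, h2, ?_⟩
  · rw [inf_sup_assoc_of_le _ hCA, sup_comm, h1.sup_eq_top, inf_top_eq]
  · exact h1.disjoint.symm.mono_left inf_le_right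
  · have h3 := (split (π ∘ₗ A.subtype ∘ₗ A.projectionOnto Q h) e he
      (by simpa [hpe] using hu)).1
    have : LinearMap.ker (π ∘ₗ A.subtype ∘ₗ A.projectionOnto Q h) = A ⊓ LinearMap.ker π ⊔ Q := by
      apply le_antisymm
      · intro n hn
        have hn' : n ∈ A ⊔ Q := by rw [h.sup_eq_top]; trivial
        obtain ⟨x, hx, y, hy, rfl⟩ := Submodule.mem_sup.1 hn'
        refine Submodule.add_mem_sup ⟨hx, ?_⟩ hy
        rw [LinearMap.mem_ker] at hn
        simp only [LinearMap.comp_apply, map_add,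
          Submodule.projectionOnto_apply_of_mem_right h hy] at hn
        rw [show A.projectionOnto Q h x = ⟨x, hx⟩ from
          Submodule.projectionOnto_apply_left h ⟨x, hx⟩] at hn
        simpa using hn
      · refine sup_le ?_ ?_
        · rintro x ⟨hx, hx'⟩
          rw [LinearMap.mem_ker, LinearMap.comp_apply, LinearMap.comp_apply,
            show A.projectionOnto Q h x = ⟨x, hx⟩ from
            Submodule.projectionOnto_apply_left h ⟨x, hx⟩]
          exact hx'
        · intro y hy
          rw [LinearMap.mem_ker, LinearMap.comp_apply, LinearMap.comp_apply,
            Submodule.projectionOnto_apply_of_mem_right h hy]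
          simp
    rwa [this] at h3

variable (I) in
noncomputable def e (i : ι) : Π₀ i, R ⧸ I i :=
  letI := Classical.decEq ι
  DFinsupp.single i (1 : R ⧸ I i)

lemma e_same (i : ι) : e I i i = 1 := by
  classical
  simp [e]

lemma e_ne {i j : ι} (h : i ≠ j) : e I i j = 0 := by
  classical
  simp only [e]
  exact DFinsupp.single_eq_of_ne h.symm

lemma e_kill (i : ι) (r : R) (hr : r ∈ I i) : r • e I i = 0 := by
  ext j
  by_cases h : i = j
  · subst h
    rw [DFinsupp.smul_apply, e_same, Algebra.smul_def, mul_one]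
    exact Ideal.Quotient.eq_zero_iff_mem.2 hr
  · rw [DFinsupp.smul_apply, e_ne h]; simp

variable (I) in
def NS (S : Set ι) : Submodule R (Π₀ i, R ⧸ I i) := Submodule.span R (e I '' S)

lemma mem_NS {S : Set ι} {n : Π₀ i, R ⧸ I i} : n ∈ NS I S ↔ ∀ i, i ∉ S → n i = 0 := by
  classical
  constructor
  · intro hn i hi
    have : NS I S ≤ LinearMap.ker (DFinsupp.lapply (R := R) i) := by
      refine Submodule.span_le.2 ?_
      rintro _ ⟨j, hj, rfl⟩
      exact e_ne (by rintro rfl; exact hi hj)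
    exact this hn
  · intro h
    rw [← DFinsupp.sum_single (f := n)]
    refine Submodule.sum_mem _ fun i hi => ?_
    have hiS : i ∈ S := by
      by_contra hc
      exact (DFinsupp.mem_support_iff.1 hi) (h i hc)
    obtain ⟨r, hr⟩ := Ideal.Quotient.mk_surjective (n i)
    have : DFinsupp.single i (n i) = r • e I i := by
      ext j
      by_cases hij : i = j
      · subst hij
        rw [DFinsupp.smul_apply, e_same, Algebra.smul_def, mul_one, DFinsupp.single_eq_same, ← hr]
        rfl
      · rw [DFinsupp.smul_apply, e_ne hij, DFinsupp.single_eq_of_ne (Ne.symm hij)]; simp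
    rw [this]
    exact Submodule.smul_mem _ _ (Submodule.subset_span ⟨i, hiS, rfl⟩)

lemma NS_univ : NS I Set.univ = ⊤ := by
  rw [eq_top_iff]; intro n _; rw [mem_NS]; intro i hi; exact absurd trivial hi

lemma finClaim [IsLocalRing R] {K K' : Submodule R (Π₀ i, R ⧸ I i)} (h : IsCompl K K')
    (F : Finset ι) : ∃ A B C : Submodule R (Π₀ i, R ⧸ I i), B ≤ K' ∧ A ⊔ C = K ∧ Disjoint A C ∧
      Good I C ∧ IsCompl (NS I F) (A ⊔ B) := by
  classical
  induction F using Finset.induction_on with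
  | empty =>
    refine ⟨K, K', ⊥, le_rfl, by simp, disjoint_bot_right, good_bot, ?_⟩
    rw [h.sup_eq_top]
    simpa [NS] using isCompl_bot_top
  | insert i F hi ih =>
    obtain ⟨A, B, C, hB, hAC, dAC, hC, hP⟩ := ih
    have hAK : A ≤ K := hAC ▸ le_sup_left
    have dAB : Disjoint A B := h.disjoint.mono hAK hB
    have cA : IsCompl A (B ⊔ NS I F) := dAB.isCompl_sup_right_of_isCompl_sup_left hP.symm
    have cB : IsCompl B (A ⊔ NS I F) :=
      dAB.symm.isCompl_sup_right_of_isCompl_sup_left (by rw [sup_comm]; exact hP.symm)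
    have hins : NS I (insert i F : Finset ι) = Submodule.span R {e I i} ⊔ NS I F := by
      rw [NS, Finset.coe_insert, Set.image_insert_eq, Submodule.span_insert]; rfl
    have hmem : e I i ∈ NS I F ⊔ (A ⊔ B) := by rw [hP.sup_eq_top]; trivial
    obtain ⟨p, hp, ab, hab, hsum⟩ := Submodule.mem_sup.1 hmem
    obtain ⟨a, ha, b, hb, rfl⟩ := Submodule.mem_sup.1 hab
    let π : (Π₀ i, R ⧸ I i) →ₗ[R] R ⧸ I i := DFinsupp.lapply (R := R) i
    have hπp : π p = 0 := mem_NS.1 hp i (by simpa using hi)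
    have h1 : π a + π b = 1 := by
      have := congrArg π hsum
      rw [map_add, map_add, hπp, zero_add] at this
      rw [this]; exact e_same i
    obtain ⟨r, hr⟩ := Ideal.Quotient.mk_surjective (π a)
    have hor : IsUnit (π a) ∨ IsUnit (π b) := by
      rcases IsLocalRing.isUnit_or_isUnit_one_sub_self r with hu | hu
      · left; rw [← hr]; exact hu.map _
      · right
        have : π b = Ideal.Quotient.mk _ (1 - r) := by
          rw [map_sub, map_one, hr, ← h1]; ring
        rw [this]; exact hu.map _
    rcases hor with hu | hu
    · obtain ⟨A1, C1, hA1, dA1, ⟨g⟩, hc⟩ := exchange π cA (e_kill i) ha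
        (Submodule.add_mem_sup hb hp) (by rw [← hsum]; abel) hu
      have hA1A : A1 ≤ A := hA1 ▸ le_sup_left
      have hC1A : C1 ≤ A := hA1 ▸ le_sup_right
      refine ⟨A1, B, C1 ⊔ C, hB, by rw [← sup_assoc, hA1, hAC], ?_, ?_, ?_⟩
      · exact dA1.disjoint_sup_right_of_disjoint_sup_left (by rw [hA1]; exact dAC)
      · exact good_sup (dAC.mono_left hC1A) ((good_cyclic i).congr g) hC
      · rw [hins]
        refine Disjoint.isCompl_sup_left_of_isCompl_sup_right
          (hP.disjoint.mono_right (sup_le_sup_right hA1A B)) ?_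
        rwa [sup_comm (NS I F), sup_assoc]
    · obtain ⟨B1, C1, hB1, dB1, -, hc⟩ := exchange π cB (e_kill i) hb
        (Submodule.add_mem_sup ha hp) (by rw [← hsum]; abel) hu
      have hB1B : B1 ≤ B := hB1 ▸ le_sup_left
      refine ⟨A, B1, C, hB1B.trans hB, hAC, dAC, hC, ?_⟩
      rw [hins]
      refine Disjoint.isCompl_sup_left_of_isCompl_sup_right
          (hP.disjoint.mono_right (sup_le_sup_left hB1B A)) ?_
      rwa [sup_comm (NS I F), sup_comm A, sup_assoc]

lemma keyLemma [IsLocalRing R] {L D : Submodule R (Π₀ i, R ⧸ I i)} (h : IsCompl L D)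
    {y : Π₀ i, R ⧸ I i} (hy : y ∈ L) : ∃ C L1 D1 : Submodule R (Π₀ i, R ⧸ I i),
      C ⊔ L1 = L ∧ Disjoint C L1 ∧ Good I C ∧ y ∈ C ∧ IsCompl L1 D1 := by
  classical
  obtain ⟨A, B, C, hB, hAC, dAC, hC, hP⟩ := finClaim h y.support
  have hAL : A ≤ L := hAC ▸ le_sup_left
  have dAB : Disjoint A B := h.disjoint.mono hAL hB
  have cA : IsCompl A (B ⊔ NS I y.support) := dAB.isCompl_sup_right_of_isCompl_sup_left hP.symm
  have hyP : y ∈ NS I y.support := by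
    rw [mem_NS]; intro i hi; simpa using hi
  have h1 : L ⊓ (B ⊔ NS I y.support) ⊔ A = L := by
    rw [inf_sup_assoc_of_le _ hAL, sup_comm, cA.sup_eq_top, inf_top_eq]
  have d1 : Disjoint (L ⊓ (B ⊔ NS I y.support)) A := cA.disjoint.symm.mono_left inf_le_right
  refine ⟨L ⊓ (B ⊔ NS I y.support), A, _, h1, d1, ?_, ⟨hy, Submodule.mem_sup_right hyP⟩, cA⟩
  have c1 : IsCompl (L ⊓ (B ⊔ NS I y.support)) (A ⊔ D) :=
    d1.isCompl_sup_right_of_isCompl_sup_left (by rwa [h1])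
  have c2 : IsCompl C (A ⊔ D) :=
    dAC.symm.isCompl_sup_right_of_isCompl_sup_left (by rwa [sup_comm, hAC])
  exact hC.congr ((Submodule.quotientEquivOfIsCompl _ _ c1.symm).symm.trans
    (Submodule.quotientEquivOfIsCompl _ _ c2.symm))

lemma countable_good [IsLocalRing R] {L D : Submodule R (Π₀ i, R ⧸ I i)} (h : IsCompl L D)
    (x : ℕ → Π₀ i, R ⧸ I i) (hx : Submodule.span R (Set.range x) = L) : Good I L := by
  let St := {t : Set (Submodule R (Π₀ i, R ⧸ I i)) × Submodule R (Π₀ i, R ⧸ I i) //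
    sSupIndep t.1 ∧ (∀ C ∈ t.1, Good I C) ∧ sSup t.1 ⊔ t.2 = L ∧ Disjoint (sSup t.1) t.2 ∧
      ∃ D, IsCompl t.2 D}
  have step : ∀ (n : ℕ) (t : St), ∃ t' : St, t.1.1 ⊆ t'.1.1 ∧ x n ∈ sSup t'.1.1 := by
    rintro n ⟨⟨s, L'⟩, hs, hg, hsup, hd, D', hD'⟩
    simp only at hs hg hsup hd hD'
    have hxn : x n ∈ sSup s ⊔ L' := by
      rw [hsup, ← hx]; exact Submodule.subset_span ⟨n, rfl⟩
    obtain ⟨d, hd', y, hy, hdy⟩ := Submodule.mem_sup.1 hxn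
    obtain ⟨C, L1, D1, hC1, hC2, hC3, hC4, hC5⟩ := keyLemma hD' hy
    have hCL : C ≤ L' := hC1 ▸ le_sup_left
    refine ⟨⟨⟨insert C s, L1⟩, sSupIndep_insert' hs (hd.mono_right hCL), ?_, ?_, ?_, D1, hC5⟩,
      Set.subset_insert _ _, ?_⟩
    · rintro E (rfl | hE)
      · exact hC3
      · exact hg E hE
    · simp only [sSup_insert]
      rw [sup_comm C, sup_assoc, hC1, hsup]
    · simp only [sSup_insert]
      rw [sup_comm C]
      exact hC2.disjoint_sup_left_of_disjoint_sup_right (by rwa [hC1])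
    · simp only [sSup_insert]
      rw [← hdy, add_comm]
      exact Submodule.add_mem_sup hC4 hd'
  choose nx hsub hmem using step
  let t0 : St := ⟨⟨∅, L⟩, sSupIndep_empty, by simp, by simp, by simp, D, h⟩
  let t : ℕ → St := fun n => Nat.rec t0 (fun n t => nx n t) n
  have hmono : Monotone fun n => (t n).1.1 := monotone_nat_of_le_succ fun n => hsub n (t n)
  have hind := sSupIndep_iUnion_of_directed hmono.directed_le (fun n => (t n).2.1)
  have hgood := good_sSup (I := I) hind (by
    intro C hC
    obtain ⟨n, hn⟩ := Set.mem_iUnion.1 hC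
    exact (t n).2.2.1 C hn)
  have : sSup (⋃ n, (t n).1.1) = L := by
    apply le_antisymm
    · refine sSup_le fun C hC => ?_
      obtain ⟨n, hn⟩ := Set.mem_iUnion.1 hC
      exact (le_sSup hn).trans ((le_sup_left).trans (t n).2.2.2.1.le)
    · refine hx.symm.le.trans (Submodule.span_le.2 ?_)
      rintro _ ⟨n, rfl⟩
      exact (sSup_le_sSup (Set.subset_iUnion (fun n => (t n).1.1) (n+1))) (hmem n (t n))
  rwa [this] at hgood

lemma exists_closure (p : (Π₀ i, R ⧸ I i) →ₗ[R] Π₀ i, R ⧸ I i) (i₀ : ι) :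
    ∃ g : ℕ → ι, i₀ ∈ Set.range g ∧ ∀ i ∈ Set.range g, p (e I i) ∈ NS I (Set.range g) := by
  classical
  let G : Set ι → Set ι := fun X => ⋃ a ∈ X, ((p (e I a)).support : Set ι)
  let T : Set ι := ⋃ n : ℕ, G^[n] {i₀}
  have hcn : ∀ n : ℕ, (G^[n] {i₀}).Countable := by
    intro n
    induction n with
    | zero => exact Set.countable_singleton _
    | succ n ih =>
      rw [Function.iterate_succ_apply']
      exact ih.biUnion fun a _ => Finset.countable_toSet _
  have hc : T.Countable := Set.countable_iUnion hcn
  have h0 : i₀ ∈ T := Set.mem_iUnion.2 ⟨0, rfl⟩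
  obtain ⟨g, hg⟩ := hc.exists_eq_range ⟨i₀, h0⟩
  refine ⟨g, hg ▸ h0, ?_⟩
  rw [← hg]
  intro i hi
  rw [mem_NS]
  intro j hj
  by_contra hne
  apply hj
  obtain ⟨n, hn⟩ := Set.mem_iUnion.1 hi
  refine Set.mem_iUnion.2 ⟨n + 1, ?_⟩
  rw [Function.iterate_succ_apply']
  exact Set.mem_biUnion hn (by simpa using hne)

variable (I) in
noncomputable def prS (S : Set ι) : Module.End R (Π₀ i, R ⧸ I i) :=
  letI := Classical.decPred (· ∈ S)
  DFinsupp.filterLinearMap R _ (· ∈ S)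

lemma prS_mem (S : Set ι) (n) : prS I S n ∈ NS I S := by
  classical
  rw [mem_NS]
  intro i hi
  simp [prS, DFinsupp.filter_apply, hi]

lemma prS_eq {S : Set ι} {n} (h : n ∈ NS I S) : prS I S n = n := by
  classical
  rw [mem_NS] at h
  ext i
  by_cases hi : i ∈ S
  · simp [prS, DFinsupp.filter_apply, hi]
  · simp [prS, DFinsupp.filter_apply, hi, h i hi]

lemma prS_e {S : Set ι} {i : ι} (hi : i ∉ S) : prS I S (e I i) = 0 := by
  classical
  ext j
  by_cases hj : j ∈ S
  · simp [prS, DFinsupp.filter_apply, hj, e_ne (I := I) (show i ≠ j by rintro rfl; exact hi hj)]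
  · simp [prS, DFinsupp.filter_apply, hj]

lemma NS_mono {S T : Set ι} (h : S ⊆ T) : NS I S ≤ NS I T :=
  Submodule.span_mono (Set.image_mono h)

lemma NS_closed {p : Module.End R (Π₀ i, R ⧸ I i)} {S : Set ι} (h : ∀ i ∈ S, p (e I i) ∈ NS I S)
    {n} (hn : n ∈ NS I S) : p n ∈ NS I S := by
  have : NS I S ≤ (NS I S).comap p := by
    refine Submodule.span_le.2 ?_
    rintro _ ⟨i, hi, rfl⟩
    exact h i hi
  exact this hn

lemma range_prS (p : Module.End R (Π₀ i, R ⧸ I i)) (S : Set ι) :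
    LinearMap.range (p * prS I S) = (NS I S).map p := by
  ext x
  constructor
  · rintro ⟨n, rfl⟩
    exact ⟨_, prS_mem S n, rfl⟩
  · rintro ⟨n, hn, rfl⟩
    exact ⟨n, by rw [Module.End.mul_apply, prS_eq hn]⟩

lemma extend [IsLocalRing R] (p : Module.End R (Π₀ i, R ⧸ I i)) (hp : ∀ n, p (p n) = p n)
    (S : Set ι) (hS : ∀ i ∈ S, p (e I i) ∈ NS I S) (i₀ : ι) :
    ∃ S' : Set ι, S ⊆ S' ∧ i₀ ∈ S' ∧ (∀ i ∈ S', p (e I i) ∈ NS I S') ∧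
      ∃ C : Submodule R (Π₀ i, R ⧸ I i), Disjoint ((NS I S).map p) C ∧
        (NS I S).map p ⊔ C = (NS I S').map p ∧ Good I C := by
  obtain ⟨g, hg0, hg⟩ := exists_closure p i₀
  have hSS : S ⊆ S ∪ Set.range g := Set.subset_union_left
  have hS' : ∀ i ∈ S ∪ Set.range g, p (e I i) ∈ NS I (S ∪ Set.range g) := by
    rintro i (hi | hi)
    · exact NS_mono hSS (hS i hi)
    · exact NS_mono Set.subset_union_right (hg i hi)
  refine ⟨S ∪ Set.range g, hSS, Or.inr hg0, hS', ?_⟩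
  generalize hSdef : S ∪ Set.range g = S' at *
  obtain ⟨a, ha⟩ : ∃ a, a = p * prS I S := ⟨_, rfl⟩
  obtain ⟨b, hb⟩ : ∃ b, b = p * prS I S' := ⟨_, rfl⟩
  have aa : ∀ n, a (a n) = a n := by
    intro n
    simp only [ha, Module.End.mul_apply]
    rw [prS_eq (NS_closed hS (prS_mem S n)), hp]
  have bb : ∀ n, b (b n) = b n := by
    intro n
    simp only [hb, Module.End.mul_apply]
    rw [prS_eq (NS_closed hS' (prS_mem S' n)), hp]
  have ba : ∀ n, b (a n) = a n := by
    intro n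
    simp only [ha, hb, Module.End.mul_apply]
    rw [prS_eq (NS_mono hSS (NS_closed hS (prS_mem S n))), hp]
  obtain ⟨q, hq⟩ : ∃ q : Module.End R (Π₀ i, R ⧸ I i), ∀ n, q n = b n - a (b n) :=
    ⟨b - a * b, fun n => rfl⟩
  have aq : ∀ n, a (q n) = 0 := fun n => by rw [hq, map_sub, aa, sub_self]
  have bq : ∀ n, b (q n) = q n := fun n => by rw [hq, map_sub, ba, bb]
  have qq : IsIdempotentElem q := by
    refine LinearMap.ext fun n => ?_
    rw [Module.End.mul_apply, hq (q n), bq, aq, sub_zero]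
  have hcompl := LinearMap.IsIdempotentElem.isCompl qq
  refine ⟨LinearMap.range q, ?_, ?_, ?_⟩
  · rw [← range_prS, ← ha, Submodule.disjoint_def]
    rintro _ ⟨m, rfl⟩ ⟨n, hn⟩
    change q n = a m at hn
    change a m = 0
    rw [← aa, ← hn, aq]
  · rw [← range_prS, ← range_prS, ← ha, ← hb]
    apply le_antisymm
    · refine sup_le ?_ ?_
      · rintro _ ⟨n, rfl⟩
        exact ⟨a n, ba n⟩
      · rintro _ ⟨n, rfl⟩
        exact ⟨q n, bq n⟩
    · rintro _ ⟨n, rfl⟩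
      refine Submodule.mem_sup.2 ⟨a (b n), ⟨_, rfl⟩, q n, ⟨_, rfl⟩, ?_⟩
      simp [hq]
  · refine countable_good hcompl (fun n => q (e I (g n))) ?_
    apply le_antisymm
    · rw [Submodule.span_le]
      rintro _ ⟨n, rfl⟩
      exact ⟨_, rfl⟩
    · rw [LinearMap.range_eq_map, ← NS_univ, NS, Submodule.map_span, Submodule.span_le]
      rintro _ ⟨_, ⟨i, -, rfl⟩, rfl⟩
      by_cases hi : i ∈ Set.range g
      · obtain ⟨n, rfl⟩ := hi
        exact Submodule.subset_span ⟨n, rfl⟩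
      · have : q (e I i) = 0 := by
          by_cases hiS : i ∈ S
          · have h1 : e I i ∈ NS I S := Submodule.subset_span ⟨i, hiS, rfl⟩
            have h2 : b (e I i) = a (e I i) := by
              simp only [ha, hb, Module.End.mul_apply]
              rw [prS_eq h1, prS_eq (NS_mono hSS h1)]
            rw [hq, h2, aa, sub_self]
          · have h2 : b (e I i) = 0 := by
              rw [hb, Module.End.mul_apply, prS_e, map_zero]
              rw [← hSdef]
              rintro (h | h)
              · exact hiS h
              · exact hi h
            rw [hq, h2, map_zero, sub_self]
        rw [this]
        exact Submodule.zero_mem _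

lemma main [IsLocalRing R] (p : Module.End R (Π₀ i, R ⧸ I i)) (hp : ∀ n, p (p n) = p n) :
    Good I (LinearMap.range p) := by
  let Z : Set (Set ι × Set (Submodule R (Π₀ i, R ⧸ I i))) :=
    {t | (∀ i ∈ t.1, p (e I i) ∈ NS I t.1) ∧ sSupIndep t.2 ∧ (∀ C ∈ t.2, Good I C) ∧
      sSup t.2 = (NS I t.1).map p}
  obtain ⟨⟨S, s⟩, hm⟩ : ∃ m, Maximal (· ∈ Z) m := by
    refine zorn_le₀ Z fun c hcZ hc => ?_
    refine ⟨(⋃ t : c, t.1.1, ⋃ t : c, t.1.2), ⟨?_, ?_, ?_, ?_⟩, ?_⟩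
    · intro i hi
      obtain ⟨t, ht⟩ := Set.mem_iUnion.1 hi
      exact NS_mono (Set.subset_iUnion (fun t : c => t.1.1) t) ((hcZ t.2).1 i ht)
    · refine sSupIndep_iUnion_of_directed ?_ fun t => (hcZ t.2).2.1
      intro t t'
      rcases hc.total t.2 t'.2 with h | h
      · exact ⟨t', h.2, subset_rfl⟩
      · exact ⟨t, subset_rfl, h.2⟩
    · intro C hC
      obtain ⟨t, ht⟩ := Set.mem_iUnion.1 hC
      exact (hcZ t.2).2.2.1 C ht
    · simp only [NS, Set.image_iUnion, Submodule.span_iUnion, Submodule.map_iSup]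
      rw [sSup_iUnion]
      refine iSup_congr fun t => ?_
      exact (hcZ t.2).2.2.2
    · intro t ht
      exact ⟨Set.subset_iUnion (fun t : c => t.1.1) ⟨t, ht⟩,
        Set.subset_iUnion (fun t : c => t.1.2) ⟨t, ht⟩⟩
  obtain ⟨h1, h2, h3, h4⟩ := hm.prop
  simp only at h1 h2 h3 h4
  have hS : S = Set.univ := by
    refine Set.eq_univ_of_forall fun i₀ => ?_
    obtain ⟨S', hSS, hi, hS', C, hd, hsup, hC⟩ := extend p hp S h1 i₀
    have hZ : (S', insert C s) ∈ Z := by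
      refine ⟨hS', sSupIndep_insert' h2 (by rwa [h4]), ?_, ?_⟩
      · rintro E (rfl | hE)
        · exact hC
        · exact h3 E hE
      · simp only [sSup_insert]
        rw [h4, sup_comm, hsup]
    exact (hm.le_of_ge hZ ⟨hSS, Set.subset_insert _ _⟩).1 hi
  have := good_sSup h2 h3
  rwa [h4, hS, NS_univ, ← LinearMap.range_eq_map] at this

end
end SummandAux

theorem summand_of_direct_sum_of_cyclics_over_local_ring
    {R : Type} [CommRing R] [IsLocalRing R] {ι : Type} (I : ι → Ideal R)
    (K K' : Type) [AddCommGroup K] [Module R K] [AddCommGroup K'] [Module R K']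
    (h : Nonempty ((K × K') ≃ₗ[R] ⨁ i, R ⧸ I i)) :
    ∃ (J : Type) (f : J → ι), Nonempty (K ≃ₗ[R] ⨁ j, R ⧸ I (f j)) := by
  obtain ⟨φ⟩ := h
  let φ' : (K × K') ≃ₗ[R] Π₀ i, R ⧸ I i := φ
  let j : K →ₗ[R] Π₀ i, R ⧸ I i := φ'.toLinearMap ∘ₗ LinearMap.inl R K K'
  let p : Module.End R (Π₀ i, R ⧸ I i) := j ∘ₗ LinearMap.fst R K K' ∘ₗ φ'.symm.toLinearMap
  have hp : ∀ n, p (p n) = p n := by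
    intro n
    simp [p, j]
  have hj : Function.Injective j := φ'.injective.comp LinearMap.inl_injective
  have hr : LinearMap.range p = LinearMap.range j := by
    apply le_antisymm
    · rintro _ ⟨n, rfl⟩
      exact ⟨_, rfl⟩
    · rintro _ ⟨k, rfl⟩
      exact ⟨j k, by simp [p, j]⟩
  have hg := SummandAux.main p hp
  rw [hr] at hg
  exact hg.congr (LinearEquiv.ofInjective j hj)
end

section
/- Let (R, M) be a commutative local ring. If every prime ideal of R is a direct summand of a direct sum of cyclic R-modules, then every prime ideal of R is itself a direct sum of cyclic R-modules. -/
/-- An ideal `P` of a commutative ring `R` is an internal direct sum of cyclic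
`R`-modules: there is a family of elements of `P` whose cyclic spans are
independent and whose supremum is `P`. -/
def IsDirectSumOfCyclics {R : Type} [CommRing R] (P : Ideal R) : Prop :=
  ∃ (ι : Type) (w : ι → R), (∀ i, w i ∈ P) ∧
    iSupIndep (fun i => Ideal.span {w i}) ∧ (⨆ i, Ideal.span {w i}) = P

open DirectSum


open IsLocalRing

/-- concrete dual basis data for the maximal ideal -/
structure DB (R : Type) [CommRing R] [IsLocalRing R] where
  ι : Type
  I : ι → Ideal R
  w : ι → R
  a : ι → R → R
  hw : ∀ k, w k ∈ maximalIdeal R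
  hIw : ∀ k r, r ∈ I k → r * w k = 0
  hadd : ∀ k x y, x ∈ maximalIdeal R → y ∈ maximalIdeal R →
    a k (x + y) - (a k x + a k y) ∈ I k
  hsm : ∀ k r x, x ∈ maximalIdeal R → a k (r * x) - r * a k x ∈ I k
  hfin : ∀ x, x ∈ maximalIdeal R → {k | a k x ∉ I k}.Finite
  hsum : ∀ x, x ∈ maximalIdeal R → ∃ F : Finset ι, x = ∑ k ∈ F, a k x * w k

theorem DB.exists_of {R : Type} [CommRing R] [IsLocalRing R]
    {ι : Type} (I : ι → Ideal R)
    (f : (maximalIdeal R) →ₗ[R] ⨁ i, R ⧸ I i) (g : (⨁ i, R ⧸ I i) →ₗ[R] (maximalIdeal R))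
    (hgf : g.comp f = LinearMap.id) : Nonempty (DB R) := by
  classical
  have hout : ∀ k (q : R ⧸ I k), Ideal.Quotient.mk (I k) (Quotient.out q) = q :=
    fun k q => Quotient.out_eq q
  let a : ι → R → R := fun k x =>
    if hx : x ∈ maximalIdeal R then Quotient.out (f ⟨x, hx⟩ k) else 0
  have ha : ∀ k x (hx : x ∈ maximalIdeal R), Ideal.Quotient.mk (I k) (a k x) = f ⟨x, hx⟩ k := by
    intro k x hx
    simp only [a, dif_pos hx]
    exact hout k _
  let w : ι → R := fun k => (g (DirectSum.lof R ι (fun i => R ⧸ I i) k (Ideal.Quotient.mk _ 1)) : R)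
  have hgw : ∀ k r, (g (DirectSum.lof R ι (fun i => R ⧸ I i) k (Ideal.Quotient.mk _ r)) : R)
      = r * w k := by
    intro k r
    have : Ideal.Quotient.mk (I k) r = r • Ideal.Quotient.mk (I k) 1 := by
      rw [← Ideal.Quotient.mk_eq_mk, ← Ideal.Quotient.mk_eq_mk, ← Submodule.Quotient.mk_smul]
      simp
    rw [this, map_smul, map_smul]
    rfl
  refine ⟨⟨ι, I, w, a, fun k => (g _).2, ?_, ?_, ?_, ?_, ?_⟩⟩
  · intro k r hr
    rw [← hgw, Ideal.Quotient.eq_zero_iff_mem.2 hr]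
    simp
  · intro k x y hx hy
    rw [← Ideal.Quotient.eq, map_add, ha k x hx, ha k y hy, ha k _ (add_mem hx hy)]
    have : (⟨x + y, add_mem hx hy⟩ : maximalIdeal R) = ⟨x, hx⟩ + ⟨y, hy⟩ := rfl
    rw [this, map_add]
    rfl
  · intro k r x hx
    rw [← Ideal.Quotient.eq, map_mul, ha k x hx, ha k _ (Ideal.mul_mem_left _ r hx)]
    have : (⟨r * x, Ideal.mul_mem_left _ r hx⟩ : maximalIdeal R) = r • ⟨x, hx⟩ := rfl
    rw [this, map_smul]
    rfl
  · intro x hx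
    refine (DFinsupp.support (f ⟨x, hx⟩)).finite_toSet.subset ?_
    intro k hk
    replace hk : a k x ∉ I k := hk
    rw [← Ideal.Quotient.eq_zero_iff_mem, ha k x hx] at hk
    simpa using hk
  · intro x hx
    refine ⟨DFinsupp.support (f ⟨x, hx⟩), ?_⟩
    have h1 : g (f ⟨x, hx⟩) = ⟨x, hx⟩ := by
      have := LinearMap.congr_fun hgf ⟨x, hx⟩
      simpa using this
    have h2 : f ⟨x, hx⟩ = ∑ k ∈ DFinsupp.support (f ⟨x, hx⟩),
        DirectSum.lof R ι (fun i => R ⧸ I i) k (f ⟨x, hx⟩ k) :=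
      (DirectSum.sum_support_of (f ⟨x, hx⟩)).symm
    have h3 := congrArg (fun z => ((g z : maximalIdeal R) : R)) h2
    simp only [map_sum, h1] at h3
    refine h3.trans ?_
    push_cast
    refine Finset.sum_congr rfl fun k _ => ?_
    rw [← hgw, ha k x hx]

theorem nak_summand {R : Type} [CommRing R] [IsLocalRing R] {N : Type} [AddCommGroup N]
    [Module R N] {ι : Type} (I : ι → Ideal R)
    (f : N →ₗ[R] ⨁ i, R ⧸ I i) (g : (⨁ i, R ⧸ I i) →ₗ[R] N)
    (hgf : ∀ x, g (f x) = x) (hm : ∀ x : N, x ∈ maximalIdeal R • (⊤ : Submodule R N)) :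
    ∀ x : N, x = 0 := by
  classical
  intro x
  let F : Finset ι := DFinsupp.support (f x)
  let w : ι → N := fun k => g (DirectSum.lof R ι (fun i => R ⧸ I i) k (Ideal.Quotient.mk _ 1))
  let p : N →ₗ[R] N := ∑ k ∈ F, g ∘ₗ DirectSum.lof R ι (fun i => R ⧸ I i) k ∘ₗ
    DirectSum.component R ι (fun i => R ⧸ I i) k ∘ₗ f
  let W : Submodule R N := Submodule.span R (w '' (F : Set ι))
  have hW : W.FG := Submodule.fg_span (F.finite_toSet.image w)
  have hpx : p x = x := by
    have h2 : f x = ∑ k ∈ F, DirectSum.lof R ι (fun i => R ⧸ I i) k (f x k) :=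
      (DirectSum.sum_support_of (f x)).symm
    have h3 := congrArg g h2
    rw [hgf, map_sum] at h3
    simp only [p, LinearMap.sum_apply, LinearMap.comp_apply]
    exact h3.symm
  have hpW : ∀ y, p y ∈ W := by
    intro y
    simp only [p, LinearMap.sum_apply, LinearMap.comp_apply]
    refine Submodule.sum_mem _ fun k hk => ?_
    obtain ⟨r, hr⟩ := Ideal.Quotient.mk_surjective (DirectSum.component R ι (fun i => R ⧸ I i) k (f y))
    have : DirectSum.component R ι (fun i => R ⧸ I i) k (f y) = r • Ideal.Quotient.mk (I k) 1 := by
      rw [← hr]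
      rw [← Ideal.Quotient.mk_eq_mk, ← Ideal.Quotient.mk_eq_mk, ← Submodule.Quotient.mk_smul]
      simp
    rw [this, map_smul, map_smul]
    exact W.smul_mem _ (Submodule.subset_span ⟨k, hk, rfl⟩)
  have hpm : ∀ y, p y ∈ maximalIdeal R • W := by
    intro y
    have h1 : p y ∈ (maximalIdeal R • (⊤ : Submodule R N)).map p := ⟨y, hm y, rfl⟩
    rw [Submodule.map_smul''] at h1
    refine Submodule.smul_mono le_rfl ?_ h1
    rintro _ ⟨z, -, rfl⟩
    exact hpW z
  let q : N →ₗ[R] N := LinearMap.id - p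
  have hmap : ∀ y ∈ W, q y ∈ W := fun y hy => W.sub_mem hy (hpW y)
  have hle : W ≤ W.map q := by
    refine Submodule.le_of_le_smul_of_le_jacobson_bot (I := maximalIdeal R) hW
      (IsLocalRing.maximalIdeal_le_jacobson _) ?_
    intro y hy
    have : y = q y + p y := by simp [q]
    rw [this]
    exact Submodule.add_mem_sup ⟨y, hy, rfl⟩ (hpm y)
  have : Module.Finite R W := Module.Finite.iff_fg.2 hW
  have hsurj : Function.Surjective (q.restrict hmap) := by
    rintro ⟨y, hy⟩
    obtain ⟨z, hz, hzy⟩ := hle hy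
    exact ⟨⟨z, hz⟩, Subtype.ext hzy⟩
  have hinj := OrzechProperty.injective_of_surjective_endomorphism _ hsurj
  have hxW : x ∈ W := hpx ▸ hpW x
  have h0 : q.restrict hmap ⟨x, hxW⟩ = 0 := by
    apply Subtype.ext
    simp [LinearMap.restrict_apply, q, hpx]
  have := hinj (h0.trans (map_zero _).symm)
  simpa using this

theorem soc_basis (R : Type) [CommRing R] [IsLocalRing R] :
    ∃ (κ : Type) (b : κ → R), (∀ i, b i ∈ maximalIdeal R ∧ ∀ r ∈ maximalIdeal R, r * b i = 0) ∧
      (∀ x ∈ maximalIdeal R, (∀ r ∈ maximalIdeal R, r * x = 0) →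
        x ∈ Ideal.span (Set.range b) ⊔ maximalIdeal R ^ 2) ∧
      (∀ (s : Finset κ) (r : κ → R), ∑ i ∈ s, r i * b i ∈ maximalIdeal R ^ 2 →
        ∀ i ∈ s, r i ∈ maximalIdeal R) := by
  classical
  let S := {x : maximalIdeal R // ∀ r ∈ maximalIdeal R, r * (x : R) = 0}
  let v : S → CotangentSpace R := fun x => (maximalIdeal R).toCotangent x.1
  obtain ⟨κ, c, hc, hspan, hli⟩ := exists_linearIndependent' (ResidueField R) v
  refine ⟨κ, fun i => ((c i).1 : R), fun i => ⟨(c i).1.2, (c i).2⟩, ?_, ?_⟩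
  · intro x hx hs
    have h1 : v ⟨⟨x, hx⟩, hs⟩ ∈ Submodule.span (ResidueField R) (Set.range (v ∘ c)) := by
      rw [hspan]; exact Submodule.subset_span ⟨_, rfl⟩
    rw [Finsupp.mem_span_range_iff_exists_finsupp] at h1
    obtain ⟨l, hl⟩ := h1
    choose ρ hρ using fun i => IsLocalRing.residue_surjective (l i)
    have h2 : (maximalIdeal R).toCotangent (∑ i ∈ l.support, ρ i • (c i).1)
        = (maximalIdeal R).toCotangent ⟨x, hx⟩ := by
      rw [map_sum]
      refine Eq.trans ?_ hl
      refine Finset.sum_congr rfl fun i _ => ?_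
      rw [map_smul, ← hρ i]
      exact (algebraMap_smul (ResidueField R) (ρ i) (v (c i))).symm
    rw [Ideal.toCotangent_eq] at h2
    have h3 : x = (∑ i ∈ l.support, ρ i * ((c i).1 : R)) +
      -(((∑ i ∈ l.support, ρ i • (c i).1 : maximalIdeal R) : R) - x) := by
      push_cast
      simp
    rw [h3]
    refine Submodule.add_mem_sup (Ideal.sum_mem _ fun i _ => ?_) (neg_mem h2)
    exact Ideal.mul_mem_left _ _ (Ideal.subset_span ⟨i, rfl⟩)
  · intro s r hs i hi
    rw [linearIndependent_iff'] at hli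
    have := hli s (fun i => residue R (r i)) ?_ i hi
    · rwa [residue_eq_zero_iff] at this
    · have h2 : (maximalIdeal R).toCotangent (∑ i ∈ s, r i • (c i).1) = 0 := by
        rw [Ideal.toCotangent_eq_zero]
        push_cast
        simpa using hs
      rw [map_sum] at h2
      refine Eq.trans ?_ h2
      refine Finset.sum_congr rfl fun i _ => ?_
      rw [map_smul]
      exact (algebraMap_smul (ResidueField R) (r i) (v (c i)))

section
variable {R : Type} [CommRing R] [IsLocalRing R] (D : DB R)

theorem DB.cross (k : D.ι) {x y : R} (hx : x ∈ maximalIdeal R) (hy : y ∈ maximalIdeal R) :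
    x * D.a k y - y * D.a k x ∈ D.I k := by
  have h1 := D.hsm k x y hy
  have h2 := D.hsm k y x hx
  rw [mul_comm y x] at h2
  have := (D.I k).sub_mem h2 h1
  convert this using 1
  ring

theorem mem_of_mul_unit {I : Ideal R} {r u : R} (hu : u ∉ maximalIdeal R) (h : r * u ∈ I) :
    r ∈ I := by
  have hu' : IsUnit u := by simpa using hu
  exact (Ideal.mul_unit_mem_iff_mem I hu').1 h

theorem DB.a_zero (k : D.ι) : D.a k 0 ∈ D.I k := by
  have := D.hsm k 0 0 (zero_mem _)
  simpa using this

theorem DB.ann (k : D.ι) {x r : R} (hx : x ∈ maximalIdeal R) (hu : D.a k x ∉ maximalIdeal R)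
    (hr : r * x = 0) : r ∈ D.I k := by
  have h1 := D.hsm k r x hx
  rw [hr] at h1
  have h2 := (D.I k).sub_mem (D.a_zero k) h1
  apply mem_of_mul_unit hu
  convert h2 using 1
  ring

theorem DB.gen (k : D.ι) {x y : R} (hx : x ∈ maximalIdeal R) (hu : D.a k x ∉ maximalIdeal R)
    (hy : y ∈ maximalIdeal R) (h : x * D.a k y ∈ D.I k) : y ∈ D.I k := by
  apply mem_of_mul_unit hu
  have := (D.I k).sub_mem h (D.cross k hx hy)
  convert this using 1
  ring


theorem DB.nak (D : DB R) {S : Ideal R} (h : maximalIdeal R ≤ S ⊔ maximalIdeal R ^ 2) :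
    maximalIdeal R ≤ S := by
  classical
  have key : ∀ k, ∀ x ∈ maximalIdeal R, x * D.w k ∈ S := by
    intro k
    let F := (D.hfin (D.w k) (D.hw k)).toFinset
    let N : Ideal R := Ideal.span ((fun l => D.w k * D.w l) '' (F : Set D.ι))
    have hN : N.FG := Submodule.fg_span (F.finite_toSet.image _)
    have hmem : ∀ x ∈ maximalIdeal R, x * D.w k ∈ N := by
      intro x hx
      obtain ⟨G, hG⟩ := D.hsum x hx
      rw [hG, Finset.sum_mul]
      refine Ideal.sum_mem _ fun l _ => ?_
      by_cases hl : l ∈ F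
      · have : D.a l x * D.w l * D.w k = D.a l x * (D.w k * D.w l) := by ring
        rw [this]
        exact Ideal.mul_mem_left _ _ (Ideal.subset_span ⟨l, hl, rfl⟩)
      · have h1 : D.a l (D.w k) ∈ D.I l := by
          by_contra hcon
          exact hl ((D.hfin (D.w k) (D.hw k)).mem_toFinset.2 hcon)
        have h2 := D.cross l hx (D.hw k)
        have h3 : D.w k * D.a l x ∈ D.I l := by
          have := (D.I l).sub_mem (Ideal.mul_mem_left _ x h1) h2
          convert this using 1
          ring
        have h4 := D.hIw l _ h3
        have : D.a l x * D.w l * D.w k = 0 := by linear_combination h4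
        rw [this]
        exact zero_mem _
    have hle : N ≤ S := by
      refine Submodule.le_of_le_smul_of_le_jacobson_bot (I := maximalIdeal R) hN
        (IsLocalRing.maximalIdeal_le_jacobson _) ?_
      refine Ideal.span_le.2 ?_
      rintro _ ⟨l, hl, rfl⟩
      obtain ⟨s, hs, t, ht, hst⟩ := Submodule.mem_sup.1 (h (D.hw l))
      have e : D.w k * D.w l = s * D.w k + t * D.w k := by rw [← hst]; ring
      change D.w k * D.w l ∈ _
      rw [e]
      refine Submodule.add_mem_sup (Ideal.mul_mem_right _ _ hs) ?_
      rw [pow_two] at ht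
      refine Submodule.mul_induction_on ht ?_ ?_
      · intro a ha b hb
        have : a * b * D.w k = a • (b * D.w k) := by rw [smul_eq_mul]; ring
        rw [this]
        exact Submodule.smul_mem_smul ha (hmem b hb)
      · intro a b ha hb
        rw [add_mul]
        exact add_mem ha hb
    exact fun x hx => hle (hmem x hx)
  have h2 : maximalIdeal R ^ 2 ≤ S := by
    rw [pow_two]
    refine Ideal.mul_le.2 fun x hx y hy => ?_
    obtain ⟨G, hG⟩ := D.hsum y hy
    rw [hG, Finset.mul_sum]
    refine Ideal.sum_mem _ fun l _ => ?_
    have : x * (D.a l y * D.w l) = D.a l y * (x * D.w l) := by ring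
    rw [this]
    exact Ideal.mul_mem_left _ _ (key l x hx)
  exact h.trans (sup_le le_rfl h2)

/-- good ideals -/
def DB.Good (J : Ideal R) : Prop :=
  ∃ k, D.I k = J ∧ J ≠ ⊤ ∧ ∃ y ∈ maximalIdeal R, D.a k y ∉ maximalIdeal R

theorem DB.wf : WellFounded (fun J I : Ideal R => I < J ∧ D.Good J) := by
  rw [wellFounded_iff_isEmpty_descending_chain]
  refine ⟨fun ⟨J, hJ⟩ => ?_⟩
  have hmono : StrictMono J := strictMono_nat_of_lt_succ fun n => (hJ n).1
  choose k hk htop y hy hu using fun n => (hJ n).2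
  have hinj : Function.Injective k := by
    intro a b hab
    have : J (a + 1) = J (b + 1) := by rw [← hk a, ← hk b, hab]
    have := hmono.injective this
    omega
  have hfin := D.hfin (y 0) (hy 0)
  obtain ⟨n, hn⟩ : ∃ n, k n ∉ {k | D.a k (y 0) ∉ D.I k} := by
    by_contra! hcon
    exact Set.infinite_of_injective_forall_mem hinj hcon hfin
  replace hn : D.a (k n) (y 0) ∈ D.I (k n) := by
    by_contra hcon; exact hn hcon
  have h0 : y 0 ∈ J (n + 1) := by
    rw [← hk n]
    exact D.gen (k n) (hy n) (hu n) (hy 0) (Ideal.mul_mem_left _ _ hn)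
  have hle : maximalIdeal R ≤ J (n + 1) := by
    intro z hz
    have h1 := D.cross (k 0) (hy 0) hz
    rw [hk 0] at h1
    have h2 := hmono.monotone (show 0 + 1 ≤ n + 1 by omega) h1
    refine mem_of_mul_unit (hu 0) ?_
    have := (J (n+1)).sub_mem (Ideal.mul_mem_right (D.a (k 0) z) _ h0) h2
    convert this using 1
    ring
  have h1 : J (n + 1) ≤ maximalIdeal R := le_maximalIdeal (htop n)
  have h2 : J (n + 2) ≤ maximalIdeal R := le_maximalIdeal (htop (n + 1))
  have h3 : J (n + 1) < J (n + 2) := hmono (by omega)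
  exact absurd (h3.trans_le h2) (not_lt_of_ge hle)

/-- types -/
def DB.Ty (J : Ideal R) : Prop :=
  J ≠ maximalIdeal R ∧ J ≠ ⊤ ∧ ∃ k, D.I k = J ∧ ∃ x ∈ maximalIdeal R, (∀ r ∈ J, r * x = 0) ∧
    D.a k x ∉ maximalIdeal R

theorem DB.spanning (k : {J // D.Ty J} → D.ι) (z : {J // D.Ty J} → R)
    (hk : ∀ J, D.I (k J) = J.1) (hz : ∀ J, z J ∈ maximalIdeal R)
    (hJz : ∀ J, ∀ r ∈ J.1, r * z J = 0) (hu : ∀ J, D.a (k J) (z J) ∉ maximalIdeal R)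
    (S : Ideal R) (hS1 : ∀ x ∈ maximalIdeal R, (∀ r ∈ maximalIdeal R, r * x = 0) →
        x ∈ S ⊔ maximalIdeal R ^ 2) (hS2 : ∀ J, z J ∈ S) : maximalIdeal R ≤ S := by
  apply D.nak
  suffices H : ∀ I : Ideal R, ∀ x ∈ maximalIdeal R, (∀ r ∈ I, r * x = 0) →
      x ∈ S ⊔ maximalIdeal R ^ 2 by
    intro x hx
    exact H ⊥ x hx (by intro r hr; rw [Ideal.mem_bot] at hr; simp [hr])
  intro I
  induction I using D.wf.induction with
  | _ I IH =>
  have aux : ∀ y ∈ maximalIdeal R, (∀ r ∈ I, r * y = 0) →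
      (∀ k, D.I k = I → I ≠ ⊤ → D.a k y ∈ maximalIdeal R) → y ∈ S ⊔ maximalIdeal R ^ 2 := by
    intro y hy hIy hyk
    obtain ⟨F, hF⟩ := D.hsum y hy
    rw [hF]
    refine Ideal.sum_mem _ fun l _ => ?_
    by_cases ht : D.I l = ⊤
    · have := D.hIw l 1 (by rw [ht]; trivial)
      rw [one_mul] at this
      rw [this, mul_zero]
      exact zero_mem _
    by_cases ha : D.a l y ∈ maximalIdeal R
    · refine Ideal.mem_sup_right ?_
      rw [pow_two]
      exact Ideal.mul_mem_mul ha (D.hw l)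
    refine Ideal.mul_mem_left _ _ ?_
    have hle : I ≤ D.I l := fun r hr => D.ann l hy ha (hIy r hr)
    have hne : I ≠ D.I l := by
      intro he
      exact ha (hyk l he.symm (he ▸ ht))
    exact IH (D.I l) ⟨lt_of_le_of_ne hle hne, l, rfl, ht, y, hy, ha⟩ _ (D.hw l) (D.hIw l)
  intro x hx hIx
  by_cases hIm : I = maximalIdeal R
  · exact hS1 x hx (hIm ▸ hIx)
  by_cases hex : ∀ k, D.I k = I → I ≠ ⊤ → D.a k x ∈ maximalIdeal R
  · exact aux x hx hIx hex
  push Not at hex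
  obtain ⟨l, hl, htop, hlu⟩ := hex
  let J : {J // D.Ty J} := ⟨I, hIm, htop, l, hl, x, hx, hIx, hlu⟩
  have hkJ : D.I (k J) = I := hk J
  have hJz' : ∀ r ∈ I, r * z J = 0 := hJz J
  have hun : IsUnit (D.a (k J) (z J)) := by simpa using hu J
  obtain ⟨v, hv⟩ := hun.exists_right_inv
  set α := D.a (k J) (z J) with hα
  set c := D.a (k J) x * v with hc
  have hzc : c * z J ∈ S := Ideal.mul_mem_left _ _ (hS2 J)
  have hκI : x - c * z J ∈ I := by
    have h1 := D.cross (k J) (hz J) hx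
    rw [hkJ, ← hα] at h1
    have : x - c * z J = -v * (z J * D.a (k J) x - x * α) := by
      rw [hc]; linear_combination (-x) * hv
    rw [this]
    exact Ideal.mul_mem_left _ _ h1
  have hκm : x - c * z J ∈ maximalIdeal R := sub_mem hx (Ideal.mul_mem_left _ _ (hz J))
  have hκz := hJz' _ hκI
  have hzI : z J ∉ I := by
    intro hzI
    apply hIm
    refine le_antisymm (le_maximalIdeal htop) fun t ht => ?_
    rw [← hkJ]
    refine D.gen (k J) (hz J) (hu J) ht ?_
    rw [hkJ]
    exact Ideal.mul_mem_right _ _ hzI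
  have hκ : x - c * z J ∈ S ⊔ maximalIdeal R ^ 2 := by
    refine aux _ hκm ?_ ?_
    · intro r hr
      linear_combination hIx r hr - c * hJz' r hr
    · intro k' hk' _
      by_contra hcon
      apply hzI
      rw [← hk']
      exact D.ann k' hκm hcon (by linear_combination hκz)
  have := add_mem hκ (Ideal.mem_sup_left (T := maximalIdeal R ^ 2) hzc)
  simpa using this

theorem DB.prod_zero {I J : Ideal R} {i j : D.ι} {x y : R} (hi : D.I i = I) (hj : D.I j = J)
    (hx : x ∈ maximalIdeal R) (hy : y ∈ maximalIdeal R)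
    (hIx : ∀ r ∈ I, r * x = 0) (hJy : ∀ r ∈ J, r * y = 0)
    (hix : D.a i x ∉ maximalIdeal R) (hjy : D.a j y ∉ maximalIdeal R) (hne : I ≠ J) :
    y * x = 0 := by
  apply hIx
  have hcc : D.a i y * D.a j x ∈ maximalIdeal R := by
    by_contra hcon
    have h1 : D.a i y ∉ maximalIdeal R := fun h => hcon (Ideal.mul_mem_right _ _ h)
    have h2 : D.a j x ∉ maximalIdeal R := fun h => hcon (Ideal.mul_mem_left _ _ h)
    apply hne
    apply le_antisymm
    · intro r hr
      rw [← hj]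
      exact D.ann j hx h2 (hIx r hr)
    · intro r hr
      rw [← hi]
      exact D.ann i hy h1 (hJy r hr)
  have hunit : D.a i x * D.a j y - D.a i y * D.a j x ∉ maximalIdeal R := by
    intro h
    have := add_mem h hcc
    rw [sub_add_cancel] at this
    rcases (maximalIdeal.isMaximal R).isPrime.mem_or_mem this with h | h
    · exact hix h
    · exact hjy h
  refine mem_of_mul_unit hunit ?_
  have h1 := D.cross j hx hy
  rw [hj] at h1
  have h2 := hJy _ h1
  have h3 : (D.a j y * y) * x = (D.a j x * y) * y := by linear_combination h2
  have h4 := D.hsm i (D.a j y * y) x hx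
  have h5 := D.hsm i (D.a j x * y) y hy
  rw [h3] at h4
  rw [hi] at h4 h5
  have := sub_mem h5 h4
  convert this using 1
  ring


theorem DB.main (D : DB R) : ∃ (κ : Type) (w : κ → R), (∀ i, w i ∈ maximalIdeal R) ∧
    (iSupIndep fun i => Ideal.span {w i}) ∧ (⨆ i, Ideal.span {w i}) = maximalIdeal R ∧
    (∀ i j, i ≠ j → w i * w j = 0) ∧
    (∀ i, w i * w i ≠ 0 → ∃ θ : maximalIdeal R →ₗ[R] R, (∀ x, θ x ∈ Ideal.span {w i}) ∧
      ∀ x : maximalIdeal R, (x : R) = w i → θ x = w i) := by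
  classical
  obtain ⟨κ, b, hb, hbs, hbi⟩ := soc_basis R
  have hT : ∀ J : {J // D.Ty J}, ∃ k, D.I k = J.1 ∧ ∃ x ∈ maximalIdeal R,
    (∀ r ∈ J.1, r * x = 0) ∧ D.a k x ∉ maximalIdeal R := fun J => J.2.2.2
  choose k hk z hz hJz hu using hT
  let W : {J // D.Ty J} ⊕ κ → R := Sum.elim z b
  have hWm : ∀ i, W i ∈ maximalIdeal R := by
    rintro (J | i)
    · exact hz J
    · exact (hb i).1
  have hprod : ∀ i j, i ≠ j → W i * W j = 0 := by
    rintro (I | i) (J | j) hij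
    · exact D.prod_zero (hk J) (hk I) (hz J) (hz I) (hJz J) (hJz I) (hu J) (hu I)
        (fun h => hij (congrArg Sum.inl (Subtype.ext h.symm)))
    · exact (hb j).2 _ (hz I)
    · exact (mul_comm _ _).trans ((hb i).2 _ (hz J))
    · exact (hb j).2 _ (hb i).1
  have hspan : (⨆ i, Ideal.span {W i}) = maximalIdeal R := by
    apply le_antisymm
    · refine iSup_le fun i => ?_
      rw [Ideal.span_singleton_le_iff_mem]
      exact hWm i
    · have hW : ∀ i, W i ∈ (⨆ i, Ideal.span {W i}) := fun i =>
        (le_iSup (fun i => Ideal.span {W i}) i) (Ideal.mem_span_singleton_self _)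
      refine D.spanning k z hk hz hJz hu _ ?_ (fun J => hW (Sum.inl J))
      intro x hx hxs
      have hle : Ideal.span (Set.range b) ≤ ⨆ i, Ideal.span {W i} := by
        rw [Ideal.span_le]
        rintro _ ⟨i, rfl⟩
        exact hW (Sum.inr i)
      have hle2 := sup_le_sup_right hle (maximalIdeal R ^ 2)
      exact hle2 (hbs x hx hxs)
  have hzJ : ∀ J, z J ∉ J.1 := by
    intro J hzI
    apply J.2.1
    refine le_antisymm (le_maximalIdeal J.2.2.1) fun t ht => ?_
    rw [← hk J]
    refine D.gen (k J) (hz J) (hu J) ht ?_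
    rw [hk J]
    exact Ideal.mul_mem_right _ _ hzI
  have hWJ : ∀ J i, i ≠ Sum.inl J → W i ∈ J.1 := by
    intro J i hi
    rw [← hk J]
    exact D.ann (k J) (hz J) (hu J) (hprod i (Sum.inl J) hi)
  have hnon : ∀ J i, i ≠ Sum.inl J → D.a (k J) (W i) ∈ maximalIdeal R := by
    intro J i hi
    by_contra hcon
    apply hzJ J
    rw [← hk J]
    exact D.ann (k J) (hWm i) hcon (hprod (Sum.inl J) i hi.symm)
  have hasum : ∀ l (s : Finset ({J // D.Ty J} ⊕ κ)) (r : ({J // D.Ty J} ⊕ κ) → R),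
      D.a l (∑ i ∈ s, r i * W i) - ∑ i ∈ s, r i * D.a l (W i) ∈ D.I l := by
    intro l s r
    induction s using Finset.induction_on with
    | empty => simpa using D.a_zero l
    | insert i s his ih =>
      rw [Finset.sum_insert his, Finset.sum_insert his]
      have h1 := D.hadd l (r i * W i) (∑ i ∈ s, r i * W i) (Ideal.mul_mem_left _ _ (hWm i))
        (Ideal.sum_mem _ fun i _ => Ideal.mul_mem_left _ _ (hWm i))
      have h2 := D.hsm l (r i) (W i) (hWm i)
      have := add_mem (add_mem h1 h2) ih
      convert this using 1
      ring
  refine ⟨_, W, hWm, ?_, hspan, hprod, ?_⟩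
  · rw [iSupIndep_iff_finsetSum_eq_zero_imp_eq_zero]
    intro s v hv h0
    have hv' : ∀ i, ∃ r, i ∈ s → v i = r * W i := by
      intro i
      by_cases hi : i ∈ s
      · obtain ⟨r, hr⟩ := Ideal.mem_span_singleton'.1 (hv i hi)
        exact ⟨r, fun _ => hr.symm⟩
      · exact ⟨0, fun h => absurd h hi⟩
    choose r hr using hv'
    have h0' : ∑ i ∈ s, r i * W i = 0 := by
      rw [← h0]
      exact Finset.sum_congr rfl fun i hi => (hr i hi).symm
    have hrel : ∀ J, ∑ i ∈ s, r i * D.a (k J) (W i) ∈ J.1 := by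
      intro J
      have h1 := hasum (k J) s r
      rw [h0'] at h1
      have := sub_mem (D.a_zero (k J)) h1
      rw [hk J] at this
      simpa using this
    have hrm1 : ∀ J, Sum.inl J ∈ s → r (Sum.inl J) ∈ maximalIdeal R := by
      intro J hJ
      have h1 := le_maximalIdeal J.2.2.1 (hrel J)
      rw [← Finset.add_sum_erase _ _ hJ] at h1
      have h2 : ∑ i ∈ s.erase (Sum.inl J), r i * D.a (k J) (W i) ∈ maximalIdeal R :=
        Ideal.sum_mem _ fun i hi =>
          Ideal.mul_mem_left _ _ (hnon J i (Finset.ne_of_mem_erase hi))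
      have h3 := (Ideal.add_mem_iff_left _ h2).1 h1
      exact mem_of_mul_unit (hu J) h3
    have hrm2 : ∀ i, Sum.inr i ∈ s → r (Sum.inr i) ∈ maximalIdeal R := by
      intro i hi
      refine hbi s.toRight (fun i => r (Sum.inr i)) ?_ i (by simpa using hi)
      have h1 : ∑ i ∈ s, r i * W i = (∑ i ∈ s.toLeft, r (Sum.inl i) * z i)
          + ∑ i ∈ s.toRight, r (Sum.inr i) * b i := by
        conv_lhs => rw [← Finset.toLeft_disjSum_toRight (u := s)]
        rw [Finset.sum_disjSum]
        rfl
      rw [h0'] at h1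
      rw [show ∑ i ∈ s.toRight, r (Sum.inr i) * b i = - ∑ i ∈ s.toLeft, r (Sum.inl i) * z i by
        linear_combination -h1]
      refine neg_mem (Ideal.sum_mem _ fun J hJ => ?_)
      rw [pow_two]
      exact Ideal.mul_mem_mul (hrm1 J (by simpa using hJ)) (hz J)
    have hrm : ∀ i ∈ s, r i ∈ maximalIdeal R := by
      rintro (J | i) hi
      · exact hrm1 J hi
      · exact hrm2 i hi
    rintro (J | i) hi
    · rw [hr _ hi]
      apply hJz J
      have h1 := hrel J
      rw [← Finset.add_sum_erase _ _ hi] at h1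
      have h2 : ∑ i ∈ s.erase (Sum.inl J), r i * D.a (k J) (W i) ∈ J.1 := by
        refine Ideal.sum_mem _ fun i hi' => ?_
        have h3 := D.cross (k J) (hrm i (Finset.mem_of_mem_erase hi')) (hWm i)
        rw [hk J] at h3
        have h4 := Ideal.mul_mem_right (D.a (k J) (r i)) _
          (hWJ J i (Finset.ne_of_mem_erase hi'))
        have := add_mem h3 h4
        simpa using this
      have h3 := (Ideal.add_mem_iff_left _ h2).1 h1
      exact mem_of_mul_unit (hu J) h3
    · rw [hr _ hi]
      exact (hb i).2 _ (hrm _ hi)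
  · rintro (J | i) hne
    · have hun : IsUnit (D.a (k J) (z J)) := by simpa using hu J
      obtain ⟨v, hv⟩ := hun.exists_right_inv
      refine ⟨⟨⟨fun x => D.a (k J) x * (v * z J), ?_⟩, ?_⟩, ?_, ?_⟩
      · intro x y
        have h1 := D.hadd (k J) x y x.2 y.2
        rw [hk J] at h1
        have := hJz J _ h1
        push_cast
        linear_combination v * this
      · intro r x
        have h1 := D.hsm (k J) r x x.2
        rw [hk J] at h1
        have := hJz J _ h1
        simp only [smul_eq_mul, RingHom.id_apply, Submodule.coe_smul]
        linear_combination v * this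
      · intro x
        exact Ideal.mem_span_singleton'.2 ⟨D.a (k J) x * v, by
          change _ = D.a (k J) x * (v * z J); simp only [W, Sum.elim_inl]; ring⟩
      · intro x hx
        change D.a (k J) x * (v * z J) = z J
        rw [hx]
        change D.a (k J) (z J) * (v * z J) = z J
        linear_combination z J * hv
    · exact absurd ((hb i).2 _ (hb i).1) hne
end

theorem primes_direct_sum_of_cyclics_of_summand
    {R : Type} [CommRing R] [IsLocalRing R]
    (h : ∀ P : Ideal R, P.IsPrime → ∃ (ι : Type) (I : ι → Ideal R)
      (f : P →ₗ[R] ⨁ i, R ⧸ I i) (g : (⨁ i, R ⧸ I i) →ₗ[R] P),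
      g.comp f = LinearMap.id) :
    ∀ P : Ideal R, P.IsPrime → IsDirectSumOfCyclics P := by
  classical
  intro P hP
  obtain ⟨_, I, f, g, hgf⟩ := h (maximalIdeal R) (maximalIdeal.isMaximal R).isPrime
  obtain ⟨D⟩ := DB.exists_of I f g hgf
  obtain ⟨κ, w, hwm, hind, hsup, hprod, hθ⟩ := D.main
  have hPm : P ≤ maximalIdeal R := le_maximalIdeal hP.ne_top
  by_cases hall : ∀ i, w i ∈ P
  · refine ⟨κ, w, hall, hind, le_antisymm ?_ ?_⟩
    · exact iSup_le fun i => (Ideal.span_singleton_le_iff_mem _).2 (hall i)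
    · rw [hsup]; exact hPm
  push Not at hall
  obtain ⟨o, ho⟩ := hall
  have hother : ∀ i, i ≠ o → w i ∈ P := by
    intro i hi
    have := hprod i o hi
    exact (hP.mem_or_mem (this ▸ zero_mem P)).resolve_right ho
  have hoo : w o * w o ≠ 0 := by
    intro h0
    rcases hP.mem_or_mem (h0 ▸ zero_mem P) with h | h <;> exact ho h
  obtain ⟨θ, hθ1, hθ2⟩ := hθ o hoo
  let Q : Ideal R := ⨆ i : {i // i ≠ o}, Ideal.span {w i}
  have hQ0 : ∀ x ∈ Q, w o * x = 0 := by
    have : Q ≤ LinearMap.ker (LinearMap.mulLeft R (w o)) := by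
      refine iSup_le fun i => (Ideal.span_singleton_le_iff_mem _).2 ?_
      rw [LinearMap.mem_ker, LinearMap.mulLeft_apply]
      exact hprod o i i.2.symm
    intro x hx
    simpa using this hx
  have hQP : Q ≤ P := iSup_le fun i => (Ideal.span_singleton_le_iff_mem _).2 (hother i i.2)
  have hdec : ∀ x ∈ maximalIdeal R, ∃ r, ∃ q ∈ Q, x = r * w o + q := by
    intro x hx
    have hle : maximalIdeal R ≤ Ideal.span {w o} ⊔ Q := by
      rw [← hsup]
      refine iSup_le fun i => ?_
      by_cases hi : i = o
      · subst hi; exact le_sup_left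
      · exact le_sup_of_le_right (le_iSup (fun i : {i // i ≠ o} => Ideal.span {w i}) ⟨i, hi⟩)
    obtain ⟨a, ha, q, hq, haq⟩ := Submodule.mem_sup.1 (hle hx)
    obtain ⟨r, rfl⟩ := Ideal.mem_span_singleton'.1 ha
    exact ⟨r, q, hq, haq.symm⟩
  let L : Ideal R := P ⊓ Ideal.span {w o}
  have hLm : ∀ x : L, ∃ y : L, x = w o • y := by
    rintro ⟨x, hxP, hx⟩
    obtain ⟨r, rfl⟩ := Ideal.mem_span_singleton'.1 hx
    have hr : r ∈ P := (hP.mem_or_mem hxP).resolve_right ho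
    obtain ⟨r', q, hq, e⟩ := hdec r (hPm hr)
    have hr' : r' * w o ∈ P := by
      have := sub_mem hr (hQP hq)
      rw [e] at this
      simpa using this
    refine ⟨⟨r' * w o, hr', Ideal.mem_span_singleton'.2 ⟨_, rfl⟩⟩, Subtype.ext ?_⟩
    simp only [Submodule.coe_smul, smul_eq_mul]
    rw [e]
    linear_combination hQ0 q hq
  obtain ⟨ι', I', f', g', hgf'⟩ := h P hP
  have hθP : ∀ x : maximalIdeal R, (x : R) ∈ P → θ x ∈ L := by
    intro x hx
    refine ⟨?_, hθ1 x⟩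
    have h1 : w o * θ x = x * w o := by
      have e : w o • x = (x : R) • (⟨w o, hwm o⟩ : maximalIdeal R) :=
        Subtype.ext (mul_comm _ _)
      have := congrArg θ e
      rw [map_smul, map_smul, hθ2 ⟨w o, hwm o⟩ rfl] at this
      exact this
    have h2 : w o * θ x ∈ P := h1 ▸ Ideal.mul_mem_right _ _ hx
    exact (hP.mem_or_mem h2).resolve_left ho
  let θP : P →ₗ[R] L :=
    (θ ∘ₗ Submodule.inclusion hPm).codRestrict L (fun x => hθP _ x.2)
  have hθL : ∀ x : L, θP (Submodule.inclusion inf_le_left x) = x := by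
    rintro ⟨x, hxP, hx⟩
    obtain ⟨r, rfl⟩ := Ideal.mem_span_singleton'.1 hx
    apply Subtype.ext
    change θ ⟨r * w o, _⟩ = r * w o
    have e : (⟨r * w o, hPm hxP⟩ : maximalIdeal R) = r • ⟨w o, hwm o⟩ := rfl
    rw [e, map_smul, hθ2 ⟨w o, hwm o⟩ rfl, smul_eq_mul]
  have hL0 : ∀ x : L, x = 0 := by
    refine nak_summand I' (f' ∘ₗ Submodule.inclusion inf_le_left) (θP ∘ₗ g') ?_ ?_
    · intro x
      have := LinearMap.congr_fun hgf' (Submodule.inclusion inf_le_left x)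
      simp only [LinearMap.comp_apply, LinearMap.id_apply] at this ⊢
      rw [this]
      exact hθL x
    · intro x
      obtain ⟨y, rfl⟩ := hLm x
      exact Submodule.smul_mem_smul (hwm o) trivial
  refine ⟨{i // i ≠ o}, fun i => w i, fun i => hother i i.2, ?_, ?_⟩
  · exact hind.comp Subtype.val_injective
  · refine le_antisymm hQP fun x hx => ?_
    obtain ⟨r, q, hq, e⟩ := hdec x (hPm hx)
    have hr : r * w o ∈ P := by
      have := sub_mem hx (hQP hq)
      rw [e] at this
      simpa using this
    have := hL0 ⟨r * w o, hr, Ideal.mem_span_singleton'.2 ⟨_, rfl⟩⟩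
    have h0 : r * w o = 0 := congrArg Subtype.val this
    rw [e, h0, zero_add]
    exact hq
end
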